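/- For an ergodic dynamical system (X, T, μ), for every grid θ and every real q, the box return time dimensions dominate the generalized return time dimensions: Δ_τ^+(θ,q) ≥ D_τ^+(q) and Δ_τ^-(θ,q) ≥ D_τ^-(q). -/

import Mathlib

open MeasureTheory Filter Set
open scoped ENNReal Topology NNReal

noncomputable section

/-- First return time of `x` to the set `A` under the map `T`;
by convention it is `0` if the orbit of `x` never returns to `A`. -/
def firstReturn {α : Type*} (T : α → α) (A : Set α) (x : α) : ℕ :=
  sInf {k : ℕ | 0 < k ∧ T^[k] x ∈ A}

/-- Extended logarithm `ℝ≥0∞ → EReal`. -/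
def elog (x : ℝ≥0∞) : EReal :=
  if x = 0 then ⊥ else if x = ⊤ then ⊤ else ((Real.log x.toReal : ℝ) : EReal)

section Generic

variable {α : Type*} [MeasurableSpace α] [PseudoMetricSpace α]

/-- The measure partition function `Γ_μ(ε,q)`. -/
def measPF (μ : Measure α) (ε q : ℝ) : ℝ≥0∞ :=
  ∫⁻ x, μ (Metric.ball x ε) ^ (q - 1) ∂μ

/-- The logarithmic measure partition function `Γ^l_μ(ε)`. -/
def measPFlog (μ : Measure α) (ε : ℝ) : ℝ :=
  ∫ x, Real.log (μ (Metric.ball x ε)).toReal ∂μ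

/-- The return time partition function `Γ_τ(ε,q)`. -/
def retPF (T : α → α) (μ : Measure α) (ε q : ℝ) : ℝ≥0∞ :=
  ∫⁻ x, (firstReturn T (Metric.ball x ε) x : ℝ≥0∞) ^ (1 - q) ∂μ

/-- The logarithmic return time partition function `Γ^l_τ(ε)`. -/
def retPFlog (T : α → α) (μ : Measure α) (ε : ℝ) : ℝ :=
  ∫ x, Real.log ((firstReturn T (Metric.ball x ε) x : ℝ))⁻¹ ∂μ

/-- The scaling exponent `(1/(q-1)) · log F(ε) / log ε`. -/
def dimScale (F : ℝ → ℝ≥0∞) (q : ℝ) (ε : ℝ) : EReal :=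
  ((((q - 1) * Real.log ε)⁻¹ : ℝ) : EReal) * elog (F ε)

/-- Upper generalized dimension obtained from a one-parameter family of partition
functions `F ε`, with the logarithmic convention at `q = 1`. -/
def dimPlus (F : ℝ → ℝ≥0∞) (Flog : ℝ → ℝ) (q : ℝ) : EReal :=
  if q = 1 then ((limsup (fun ε => Flog ε / Real.log ε) (𝓝[>] (0:ℝ)) : ℝ) : EReal)
  else limsup (dimScale F q) (𝓝[>] (0:ℝ))

/-- Lower generalized dimension. -/
def dimMinus (F : ℝ → ℝ≥0∞) (Flog : ℝ → ℝ) (q : ℝ) : EReal :=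
  if q = 1 then ((liminf (fun ε => Flog ε / Real.log ε) (𝓝[>] (0:ℝ)) : ℝ) : EReal)
  else liminf (dimScale F q) (𝓝[>] (0:ℝ))

/-- Generalized measure dimensions `D_μ^+(q)`. -/
def DmuPlus (μ : Measure α) (q : ℝ) : EReal :=
  dimPlus (fun ε => measPF μ ε q) (measPFlog μ) q

/-- Generalized measure dimensions `D_μ^-(q)`. -/
def DmuMinus (μ : Measure α) (q : ℝ) : EReal :=
  dimMinus (fun ε => measPF μ ε q) (measPFlog μ) q

/-- Return time generalized dimensions `D_τ^+(q)`. -/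
def DtauPlus (T : α → α) (μ : Measure α) (q : ℝ) : EReal :=
  dimPlus (fun ε => retPF T μ ε q) (retPFlog T μ) q

/-- Return time generalized dimensions `D_τ^-(q)`. -/
def DtauMinus (T : α → α) (μ : Measure α) (q : ℝ) : EReal :=
  dimMinus (fun ε => retPF T μ ε q) (retPFlog T μ) q

end Generic

/-- Euclidean space `ℝ^n`. -/
abbrev Euc (n : ℕ) := EuclideanSpace ℝ (Fin n)

/-- A grid in `ℝ^n` : a choice of origin and orientation, determining for every
side length `ε` a partition of `ℝ^n` into half-open cubes of side `ε`. -/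
structure Grid (n : ℕ) where
  origin : Euc n
  rot : Euc n ≃ₗᵢ[ℝ] Euc n

/-- Coordinates of a point w.r.t. a grid. -/
def Grid.coords {n : ℕ} (θ : Grid n) (x : Euc n) : Fin n → ℝ :=
  fun i => θ.rot.symm (x - θ.origin) i

/-- The cube `A_j` of side `ε` of the grid `θ`, indexed by `j : Fin n → ℤ`. -/
def Grid.box {n : ℕ} (θ : Grid n) (ε : ℝ) (j : Fin n → ℤ) : Set (Euc n) :=
  {x | ∀ i, (j i : ℝ) * ε ≤ θ.coords x i ∧ θ.coords x i < ((j i : ℝ) + 1) * ε}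

/-- The enlarged cube `Ā_j` of side `3ε` concentric with `A_j`. -/
def Grid.bigBox {n : ℕ} (θ : Grid n) (ε : ℝ) (j : Fin n → ℤ) : Set (Euc n) :=
  {x | ∀ i, ((j i : ℝ) - 1) * ε ≤ θ.coords x i ∧ θ.coords x i < ((j i : ℝ) + 2) * ε}

/-- Box measure partition function `Υ_μ(θ,ε,q) = Σ_{μ(A_j)>0} μ(A_j)^q`. -/
def boxMeasPF {n : ℕ} (μ : Measure (Euc n)) (θ : Grid n) (ε q : ℝ) : ℝ≥0∞ :=
  ∑' j : Fin n → ℤ, if μ (θ.box ε j) = 0 then 0 else μ (θ.box ε j) ^ q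

/-- Logarithmic box measure partition function `Υ^l_μ(θ,ε)`. -/
def boxMeasPFlog {n : ℕ} (μ : Measure (Euc n)) (θ : Grid n) (ε : ℝ) : ℝ :=
  ∑' j : Fin n → ℤ, (μ (θ.box ε j)).toReal * Real.log (μ (θ.box ε j)).toReal

/-- Return time box partition function `Υ_τ(θ,ε,q)`. -/
def boxRetPF {n : ℕ} (T : Euc n → Euc n) (μ : Measure (Euc n)) (θ : Grid n)
    (ε q : ℝ) : ℝ≥0∞ :=
  ∑' j : Fin n → ℤ, ∫⁻ x in θ.box ε j,
    (firstReturn T (θ.box ε j) x : ℝ≥0∞) ^ (1 - q) ∂μ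

/-- Logarithmic return time box partition function `Υ^l_τ(θ,ε)`. -/
def boxRetPFlog {n : ℕ} (T : Euc n → Euc n) (μ : Measure (Euc n)) (θ : Grid n)
    (ε : ℝ) : ℝ :=
  ∑' j : Fin n → ℤ, ∫ x in θ.box ε j,
    Real.log ((firstReturn T (θ.box ε j) x : ℝ))⁻¹ ∂μ

/-- Riedi's enhanced box partition function `Φ_μ(θ,ε,q)`. -/
def riediPF {n : ℕ} (μ : Measure (Euc n)) (θ : Grid n) (ε q : ℝ) : ℝ≥0∞ :=
  ∑' j : Fin n → ℤ, if μ (θ.box ε j) = 0 then 0 else μ (θ.bigBox ε j) ^ q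

/-- The enhanced box partition function `Ψ_μ(θ,ε,q) = Σ_{μ(A_j)>0} μ(A_j) μ(Ā_j)^{q-1}`. -/
def psiMeasPF {n : ℕ} (μ : Measure (Euc n)) (θ : Grid n) (ε q : ℝ) : ℝ≥0∞ :=
  ∑' j : Fin n → ℤ,
    if μ (θ.box ε j) = 0 then 0 else μ (θ.box ε j) * μ (θ.bigBox ε j) ^ (q - 1)

/-- The logarithmic enhanced box partition function `Ψ^l_μ(θ,ε)`. -/
def psiMeasPFlog {n : ℕ} (μ : Measure (Euc n)) (θ : Grid n) (ε : ℝ) : ℝ :=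
  ∑' j : Fin n → ℤ, (μ (θ.box ε j)).toReal * Real.log (μ (θ.bigBox ε j)).toReal

/-- The enhanced return time box partition function `Ψ_τ(θ,ε,q)`:
the integral is over `A_j` but the return is to the enlarged box `Ā_j`. -/
def psiRetPF {n : ℕ} (T : Euc n → Euc n) (μ : Measure (Euc n)) (θ : Grid n)
    (ε q : ℝ) : ℝ≥0∞ :=
  ∑' j : Fin n → ℤ, ∫⁻ x in θ.box ε j,
    (firstReturn T (θ.bigBox ε j) x : ℝ≥0∞) ^ (1 - q) ∂μ

/-- Box measure dimensions `Δ_μ^+(θ,q)`. -/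
def DeltaMuPlus {n : ℕ} (μ : Measure (Euc n)) (θ : Grid n) (q : ℝ) : EReal :=
  dimPlus (fun ε => boxMeasPF μ θ ε q) (boxMeasPFlog μ θ) q

/-- Box measure dimensions `Δ_μ^-(θ,q)`. -/
def DeltaMuMinus {n : ℕ} (μ : Measure (Euc n)) (θ : Grid n) (q : ℝ) : EReal :=
  dimMinus (fun ε => boxMeasPF μ θ ε q) (boxMeasPFlog μ θ) q

/-- Box return time dimensions `Δ_τ^+(θ,q)`. -/
def DeltaTauPlus {n : ℕ} (T : Euc n → Euc n) (μ : Measure (Euc n)) (θ : Grid n)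
    (q : ℝ) : EReal :=
  dimPlus (fun ε => boxRetPF T μ θ ε q) (boxRetPFlog T μ θ) q

/-- Box return time dimensions `Δ_τ^-(θ,q)`. -/
def DeltaTauMinus {n : ℕ} (T : Euc n → Euc n) (μ : Measure (Euc n)) (θ : Grid n)
    (q : ℝ) : EReal :=
  dimMinus (fun ε => boxRetPF T μ θ ε q) (boxRetPFlog T μ θ) q

end

theorem map_const_mul_nhdsGT_zero {C : ℝ} (hC : 0 < C) :
    map (C * ·) (𝓝[>] (0 : ℝ)) = 𝓝[>] 0 := by
  nth_rw 1 [← comap_mulLeft_nhdsGT_zero hC]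
  exact map_comap_of_surjective (mul_left_surjective₀ hC.ne') _

theorem eventually_log_neg {C : ℝ} (hC : 0 < C) :
    ∀ᶠ ε in 𝓝[>] (0 : ℝ), 0 < ε ∧ Real.log ε < 0 ∧ Real.log (C * ε) < 0 := by
  have h1 : ∀ᶠ ε in 𝓝[>] (0 : ℝ), Real.log ε < 0 :=
    Real.tendsto_log_nhdsGT_zero.eventually_lt_atBot 0
  have h2 : ∀ᶠ ε in 𝓝[>] (0 : ℝ), Real.log (C * ε) < 0 := by
    have h : ∀ᶠ ε in map (C * ·) (𝓝[>] (0 : ℝ)), Real.log ε < 0 := by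
      rwa [map_const_mul_nhdsGT_zero hC]
    exact h
  filter_upwards [h1, h2, self_mem_nhdsWithin] with ε a b c using ⟨c, a, b⟩

theorem tendsto_log_const_mul_div_log {C : ℝ} (hC : 0 < C) :
    Tendsto (fun ε => Real.log (C * ε) / Real.log ε) (𝓝[>] (0 : ℝ)) (𝓝 1) := by
  have h : Tendsto (fun ε => Real.log C / Real.log ε + 1) (𝓝[>] (0 : ℝ)) (𝓝 (0 + 1)) :=
    (Real.tendsto_log_nhdsGT_zero.const_div_atBot _).add_const 1
  rw [zero_add] at h
  refine h.congr' ?_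
  filter_upwards [eventually_log_neg hC] with ε ⟨h0, h1, _⟩
  rw [Real.log_mul hC.ne' h0.ne', add_div, div_self h1.ne]

theorem elog_mono : Monotone elog := by
  intro x y hxy
  unfold elog
  split_ifs with h1
  all_goals try simp
  all_goals try simp_all
  · exact Real.log_le_log (ENNReal.toReal_pos h1 ‹_›)
      (ENNReal.toReal_mono ‹_› hxy)

theorem elog_one : elog 1 = 0 := by simp [elog]

theorem dimScale_rescale_le {G H : ℝ → ℝ≥0∞} {q C : ℝ} (hC : 0 < C)
    (h : (q < 1 ∧ ∀ ε > 0, 1 ≤ G ε ∧ G (C * ε) ≤ H ε) ∨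
      (1 < q ∧ ∀ ε > 0, G ε ≤ 1 ∧ H ε ≤ G (C * ε))) :
    ∀ᶠ ε in 𝓝[>] (0 : ℝ), 0 ≤ dimScale G q (C * ε) ∧
      dimScale G q (C * ε) * ((Real.log (C * ε) / Real.log ε : ℝ) : EReal) ≤
        dimScale H q ε := by
  filter_upwards [eventually_log_neg hC] with ε ⟨h0, h1, h2⟩
  have hq : q - 1 ≠ 0 := by
    rcases h with h | h
    · linarith [h.1]
    · linarith [h.1]
  have key : dimScale G q (C * ε) * ((Real.log (C * ε) / Real.log ε : ℝ) : EReal) =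
      ((((q - 1) * Real.log ε)⁻¹ : ℝ) : EReal) * elog (G (C * ε)) := by
    unfold dimScale
    rw [mul_right_comm, ← EReal.coe_mul]
    have := h1.ne
    have := h2.ne
    congr 2
    field_simp
  rw [key]
  rcases h with ⟨hlt, h⟩ | ⟨hlt, h⟩
  · refine ⟨EReal.mul_nonneg ?_ ?_, ?_⟩
    · exact_mod_cast inv_nonneg.2 (mul_nonneg_of_nonpos_of_nonpos (by linarith) h2.le)
    · rw [← elog_one]
      exact elog_mono (h _ (mul_pos hC h0)).1
    · refine mul_le_mul_of_nonneg_left (elog_mono (h ε h0).2) ?_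
      exact_mod_cast inv_nonneg.2 (mul_nonneg_of_nonpos_of_nonpos (by linarith) h1.le)
  · refine ⟨EReal.mul_nonneg_iff.2 (Or.inr ⟨?_, ?_⟩), ?_⟩
    · exact_mod_cast inv_nonpos.2 (mul_nonpos_of_nonneg_of_nonpos (by linarith) h2.le)
    · rw [← elog_one]
      exact elog_mono (h _ (mul_pos hC h0)).1
    · unfold dimScale
      rw [mul_comm, mul_comm _ (elog (H ε))]
      refine EReal.mul_le_mul_of_nonpos_right (elog_mono (h ε h0).2) ?_
      exact_mod_cast inv_nonpos.2 (mul_nonpos_of_nonneg_of_nonpos (by linarith) h1.le)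

theorem limsup_liminf_le_of_rescale_ereal {f g : ℝ → EReal} {C : ℝ} (hC : 0 < C)
    (h : ∀ᶠ ε in 𝓝[>] (0 : ℝ), 0 ≤ f (C * ε) ∧
      f (C * ε) * ((Real.log (C * ε) / Real.log ε : ℝ) : EReal) ≤ g ε) :
    limsup f (𝓝[>] (0 : ℝ)) ≤ limsup g (𝓝[>] (0 : ℝ)) ∧
      liminf f (𝓝[>] (0 : ℝ)) ≤ liminf g (𝓝[>] (0 : ℝ)) := by
  set u : ℝ → EReal := fun ε => f (C * ε)
  set r : ℝ → EReal := fun ε => ((Real.log (C * ε) / Real.log ε : ℝ) : EReal)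
  have hr : liminf r (𝓝[>] (0 : ℝ)) = 1 := by
    refine Tendsto.liminf_eq ?_
    rw [← EReal.coe_one]
    exact (continuous_coe_real_ereal.tendsto 1).comp (tendsto_log_const_mul_div_log hC)
  have hr0 : 0 ≤ᶠ[𝓝[>] (0 : ℝ)] r := by
    filter_upwards [eventually_log_neg hC] with ε ⟨_, h1, h2⟩
    exact EReal.coe_nonneg.2 (div_nonneg_of_nonpos h2.le h1.le)
  have hu0 : 0 ≤ᶠ[𝓝[>] (0 : ℝ)] u := h.mono fun _ h => h.1
  have hle : u * r ≤ᶠ[𝓝[>] (0 : ℝ)] g := h.mono fun _ h => h.2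
  have hsup : limsup u (𝓝[>] (0 : ℝ)) = limsup f (𝓝[>] (0 : ℝ)) := by
    conv_rhs => rw [← map_const_mul_nhdsGT_zero hC]
    rfl
  have hinf : liminf u (𝓝[>] (0 : ℝ)) = liminf f (𝓝[>] (0 : ℝ)) := by
    conv_rhs => rw [← map_const_mul_nhdsGT_zero hC]
    rfl
  rw [← hsup, ← hinf]
  constructor
  · have := EReal.le_limsup_mul hu0.frequently hr0
    rw [hr, mul_one] at this
    exact this.trans (limsup_le_limsup hle)
  · have := EReal.le_liminf_mul hu0 hr0
    rw [hr, mul_one] at this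
    exact this.trans (liminf_le_liminf hle)

theorem limsup_liminf_le_of_rescale_real {f g : ℝ → ℝ} {C B : ℝ} (hC : 0 < C) (hB : 0 < B)
    (h : ∀ᶠ ε in 𝓝[>] (0 : ℝ), 0 ≤ f (C * ε) ∧
      f (C * ε) * (Real.log (C * ε) / Real.log ε) ≤ g ε ∧ g ε ≤ B) :
    limsup f (𝓝[>] (0 : ℝ)) ≤ limsup g (𝓝[>] (0 : ℝ)) ∧
      liminf f (𝓝[>] (0 : ℝ)) ≤ liminf g (𝓝[>] (0 : ℝ)) := by
  set u : ℝ → ℝ := fun ε => f (C * ε) with hu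
  have hsup : limsup u (𝓝[>] (0 : ℝ)) = limsup f (𝓝[>] (0 : ℝ)) := by
    conv_rhs => rw [← map_const_mul_nhdsGT_zero hC]
    rfl
  have hinf : liminf u (𝓝[>] (0 : ℝ)) = liminf f (𝓝[>] (0 : ℝ)) := by
    conv_rhs => rw [← map_const_mul_nhdsGT_zero hC]
    rfl
  have hg0 : ∀ᶠ ε in 𝓝[>] (0 : ℝ), 0 ≤ g ε := by
    filter_upwards [h, eventually_log_neg hC] with ε ⟨a, b, _⟩ ⟨_, h1, h2⟩
    exact (mul_nonneg a (div_nonneg_of_nonpos h2.le h1.le)).trans b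
  have hgB : IsBoundedUnder (· ≤ ·) (𝓝[>] (0 : ℝ)) g := ⟨B, h.mono fun _ h => h.2.2⟩
  have hgb : IsBoundedUnder (· ≥ ·) (𝓝[>] (0 : ℝ)) g := ⟨0, hg0⟩
  have hub : IsBoundedUnder (· ≥ ·) (𝓝[>] (0 : ℝ)) u := ⟨0, h.mono fun _ h => h.1⟩
  have hclose : ∀ η > 0, u ≤ᶠ[𝓝[>] (0 : ℝ)] fun ε => g ε + η := by
    intro η hη
    have hδ : 0 < min (1 / 2) (η / (2 * B)) := by positivity
    filter_upwards [h, Metric.tendsto_nhds.1 (tendsto_log_const_mul_div_log hC) _ hδ]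
      with ε ⟨a, b, c⟩ hr
    change f (C * ε) ≤ g ε + η
    rw [Real.dist_eq, lt_min_iff] at hr
    obtain ⟨hr1, hr2⟩ := hr
    have h1 := (abs_lt.1 hr1).1
    have h2 := (abs_lt.1 hr2).1
    set r := Real.log (C * ε) / Real.log ε
    have h3 : f (C * ε) ≤ 2 * B := by nlinarith
    have h4 : f (C * ε) * (1 - r) ≤ η := by
      calc f (C * ε) * (1 - r) ≤ f (C * ε) * (η / (2 * B)) :=
            mul_le_mul_of_nonneg_left (by linarith) a
        _ ≤ (2 * B) * (η / (2 * B)) := mul_le_mul_of_nonneg_right h3 (by positivity)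
        _ = η := by field_simp
    linarith
  have huB : IsBoundedUnder (· ≤ ·) (𝓝[>] (0 : ℝ)) u := by
    refine ⟨B + 1, eventually_map.2 ?_⟩
    filter_upwards [h, hclose 1 one_pos] with ε ⟨_, _, c⟩ d
    linarith
  rw [← hsup, ← hinf]
  constructor
  · refine le_of_forall_pos_le_add fun η hη => ?_
    rw [← limsup_add_const _ g η hgB hgb.isCoboundedUnder_le]
    refine limsup_le_limsup (hclose η hη) hub.isCoboundedUnder_le ?_
    refine ⟨B + η, eventually_map.2 (h.mono fun ε h => ?_)⟩
    linarith [h.2.2]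
  · refine le_of_forall_pos_le_add fun η hη => ?_
    rw [← liminf_add_const _ g η hgB.isCoboundedUnder_ge hgb]
    refine liminf_le_liminf (hclose η hη) hub (IsBoundedUnder.isCoboundedUnder_ge ?_)
    refine ⟨B + η, eventually_map.2 (h.mono fun ε h => ?_)⟩
    linarith [h.2.2]

theorem measurable_sInf_of_measurableSet {α : Type*} [MeasurableSpace α] {S : ℕ → Set α}
    (hS : ∀ k, MeasurableSet (S k)) : Measurable fun x => sInf {k : ℕ | x ∈ S k} := by
  refine measurable_of_Iic fun m => ?_
  have : (fun x => sInf {k : ℕ | x ∈ S k}) ⁻¹' Iic m =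
      (⋃ k ≤ m, S k) ∪ ⋂ k, (S k)ᶜ := by
    ext x
    simp only [mem_preimage, mem_Iic, mem_union, mem_iUnion, mem_iInter, mem_compl_iff,
      exists_prop]
    constructor
    · intro h
      by_cases hne : {k : ℕ | x ∈ S k}.Nonempty
      · exact Or.inl ⟨_, h, Nat.sInf_mem hne⟩
      · exact Or.inr fun k hk => hne ⟨k, hk⟩
    · rintro (⟨k, hk, hx⟩ | h)
      · exact (Nat.sInf_le hx).trans hk
      · simp [h]
  rw [this]
  exact (MeasurableSet.biUnion (to_countable _) fun k _ => hS k).union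
    (MeasurableSet.iInter fun k => (hS k).compl)

theorem measurable_firstReturn {α : Type*} [MeasurableSpace α] {T : α → α}
    (hT : Measurable T) {A : Set α} (hA : MeasurableSet A) : Measurable (firstReturn T A) :=
  measurable_sInf_of_measurableSet (S := fun k => {x | 0 < k ∧ T^[k] x ∈ A}) fun k =>
    (MeasurableSet.const _).inter (hT.iterate k hA)

theorem measurable_firstReturn_ball {α : Type*} [PseudoMetricSpace α] [MeasurableSpace α]
    [OpensMeasurableSpace α] [SecondCountableTopology α] {T : α → α} (hT : Measurable T)
    (ε : ℝ) : Measurable fun x => firstReturn T (Metric.ball x ε) x :=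
  measurable_sInf_of_measurableSet
    (S := fun k => {x | 0 < k ∧ T^[k] x ∈ Metric.ball x ε}) fun k =>
    (MeasurableSet.const _).inter
      (measurableSet_lt ((hT.iterate k).dist measurable_id) measurable_const)

theorem firstReturn_anti {α : Type*} {T : α → α} {A B : Set α} (hAB : A ⊆ B) {x : α}
    (h : 0 < firstReturn T A x) : 0 < firstReturn T B x ∧
      firstReturn T B x ≤ firstReturn T A x := by
  have hne : {k : ℕ | 0 < k ∧ T^[k] x ∈ A}.Nonempty := Nat.nonempty_of_pos_sInf h
  have hm := Nat.sInf_mem hne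
  have hB : firstReturn T A x ∈ {k : ℕ | 0 < k ∧ T^[k] x ∈ B} := ⟨hm.1, hAB hm.2⟩
  exact ⟨(Nat.sInf_mem ⟨_, hB⟩).1, Nat.sInf_le hB⟩

/-- Poincaré recurrence: almost every point of `A` has a genuine first return to `A`. -/
theorem ae_restrict_firstReturn_pos {α : Type*} [MeasurableSpace α] {T : α → α}
    {μ : Measure α} [IsFiniteMeasure μ] (hT : MeasurePreserving T μ μ) {A : Set α}
    (hA : MeasurableSet A) : ∀ᵐ x ∂μ.restrict A, 0 < firstReturn T A x := by
  rw [ae_restrict_iff' hA]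
  filter_upwards [hT.conservative.ae_mem_imp_frequently_image_mem hA.nullMeasurableSet]
    with x hx hxA
  obtain ⟨k, hk, hkA⟩ := frequently_atTop.1 (hx hxA) 1
  exact (Nat.sInf_mem (s := {k : ℕ | 0 < k ∧ T^[k] x ∈ A}) ⟨k, hk, hkA⟩).1

/-- Kac's inequality. -/
theorem lintegral_firstReturn_le_one {α : Type*} [MeasurableSpace α] {T : α → α}
    {μ : Measure α} [IsProbabilityMeasure μ] (hT : MeasurePreserving T μ μ) {A : Set α}
    (hA : MeasurableSet A) : ∫⁻ x in A, (firstReturn T A x : ℝ≥0∞) ∂μ ≤ 1 := by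
  set D : ℕ → Set α := fun k => ⋂ i < k, (T^[i] ⁻¹' A)ᶜ with hD
  have hDm : ∀ k, MeasurableSet (D k) := fun k =>
    MeasurableSet.biInter (to_countable _) fun i _ => (hT.measurable.iterate i hA).compl
  have hEm : ∀ k, MeasurableSet (T ⁻¹' D k) := fun k => hT.measurable (hDm k)
  have hDsucc : ∀ k, D (k + 1) = T ⁻¹' D k \ A := by
    intro k
    ext x
    simp only [hD, mem_iInter, mem_compl_iff, mem_preimage, Set.mem_sdiff,
      ← Function.iterate_succ_apply]
    constructor
    · exact fun h => ⟨fun i hi => h (i + 1) (by omega), h 0 (by omega)⟩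
    · rintro ⟨h, h0⟩ (_ | i) hi
      · exact h0
      · exact h i (by omega)
  have hsplit : ∀ k, μ (T ⁻¹' D k ∩ A) + μ (D (k + 1)) = μ (D k) := by
    intro k
    rw [hDsucc, measure_inter_add_sdiff _ hA, hT.measure_preimage (hDm k).nullMeasurableSet]
  have hsum : ∀ m, ∑ k ∈ Finset.range m, μ (T ⁻¹' D k ∩ A) + μ (D m) ≤ 1 := by
    intro m
    induction m with
    | zero => simpa using prob_le_one
    | succ m ih => rwa [Finset.sum_range_succ, add_assoc, hsplit]
  have hpt : ∀ x, (firstReturn T A x : ℝ≥0∞) ≤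
      ∑' k, (T ⁻¹' D k).indicator (fun _ => (1 : ℝ≥0∞)) x := by
    intro x
    refine le_trans (le_of_eq ?_) (ENNReal.sum_le_tsum (Finset.range (firstReturn T A x)))
    rw [Finset.sum_congr rfl (g := fun _ => (1 : ℝ≥0∞))]
    · simp
    intro k hk
    refine indicator_of_mem ?_ _
    simp only [hD, mem_preimage, mem_iInter, mem_compl_iff, ← Function.iterate_succ_apply]
    intro i hi hmem
    have : firstReturn T A x ≤ i + 1 := Nat.sInf_le ⟨i.succ_pos, hmem⟩
    have := Finset.mem_range.1 hk
    omega
  calc ∫⁻ x in A, (firstReturn T A x : ℝ≥0∞) ∂μ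
      ≤ ∫⁻ x in A, ∑' k, (T ⁻¹' D k).indicator (fun _ => (1 : ℝ≥0∞)) x ∂μ :=
        lintegral_mono hpt
    _ = ∑' k, ∫⁻ x in A, (T ⁻¹' D k).indicator (fun _ => (1 : ℝ≥0∞)) x ∂μ :=
        lintegral_tsum fun k => (measurable_const.indicator (hEm k)).aemeasurable
    _ = ∑' k, μ (T ⁻¹' D k ∩ A) := by
        simp [lintegral_indicator, hEm, Measure.restrict_apply]
    _ ≤ 1 := ENNReal.tsum_le_of_sum_range_le fun m => le_self_add.trans (hsum m)

theorem integrableOn_firstReturn {α : Type*} [MeasurableSpace α] {T : α → α}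
    {μ : Measure α} [IsProbabilityMeasure μ] (hT : MeasurePreserving T μ μ) {A : Set α}
    (hA : MeasurableSet A) : IntegrableOn (fun x => (firstReturn T A x : ℝ)) A μ ∧
      ∫ x in A, (firstReturn T A x : ℝ) ∂μ ≤ 1 := by
  have hm : Measurable fun x => (firstReturn T A x : ℝ) :=
    measurable_from_top.comp (measurable_firstReturn hT.measurable hA)
  have hle := lintegral_firstReturn_le_one hT hA
  constructor
  · refine ⟨hm.aestronglyMeasurable, ?_⟩
    rw [hasFiniteIntegral_iff_ofReal (Eventually.of_forall fun x => Nat.cast_nonneg _)]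
    simpa using hle.trans_lt ENNReal.one_lt_top
  · rw [integral_eq_lintegral_of_nonneg_ae (Eventually.of_forall fun x => Nat.cast_nonneg _)
      hm.aestronglyMeasurable]
    refine ENNReal.toReal_le_of_le_ofReal zero_le_one ?_
    simpa using hle

namespace Grid

variable {n : ℕ} (θ : Grid n) {ε : ℝ}

theorem mem_box_iff (hε : 0 < ε) (j : Fin n → ℤ) (x : Euc n) :
    x ∈ θ.box ε j ↔ ∀ i, ⌊θ.coords x i / ε⌋ = j i := by
  simp only [box, mem_ofPred_eq, Int.floor_eq_iff, le_div_iff₀ hε, div_lt_iff₀ hε]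

theorem iUnion_box (hε : 0 < ε) : ⋃ j, θ.box ε j = univ :=
  eq_univ_of_forall fun x => mem_iUnion.2 ⟨fun i => ⌊θ.coords x i / ε⌋,
    (θ.mem_box_iff hε _ x).2 fun _ => rfl⟩

theorem pairwise_disjoint_box (hε : 0 < ε) :
    Pairwise (Function.onFun Disjoint (θ.box ε)) := by
  intro j k hjk
  refine disjoint_left.2 fun x hj hk => hjk (funext fun i => ?_)
  rw [← (θ.mem_box_iff hε j x).1 hj i, (θ.mem_box_iff hε k x).1 hk i]

theorem continuous_coords (i : Fin n) : Continuous fun x => θ.coords x i := by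
  unfold coords
  fun_prop

theorem measurableSet_box (ε : ℝ) (j : Fin n → ℤ) : MeasurableSet (θ.box ε j) := by
  have : θ.box ε j = ⋂ i, (fun x => θ.coords x i) ⁻¹'
      Ico ((j i : ℝ) * ε) (((j i : ℝ) + 1) * ε) := by
    ext x
    simp [box]
  rw [this]
  exact MeasurableSet.iInter fun i => (θ.continuous_coords i).measurable measurableSet_Ico

theorem dist_eq_sqrt_coords (x y : Euc n) :
    dist x y = √(∑ i, (θ.coords x i - θ.coords y i) ^ 2) := by
  have h : dist x y = dist (θ.rot.symm (x - θ.origin)) (θ.rot.symm (y - θ.origin)) := by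
    simp
  rw [h, EuclideanSpace.dist_eq]
  simp [coords, Real.dist_eq, sq_abs]

theorem abs_coords_le (x : Euc n) (i : Fin n) : |θ.coords x i| ≤ dist x θ.origin := by
  calc |θ.coords x i| ≤ ‖θ.rot.symm (x - θ.origin)‖ :=
        PiLp.norm_apply_le (θ.rot.symm (x - θ.origin)) i
    _ = dist x θ.origin := by rw [LinearIsometryEquiv.norm_map, dist_eq_norm]

theorem box_subset_ball (hε : 0 < ε) {j : Fin n → ℤ} {x : Euc n} (hx : x ∈ θ.box ε j) :
    θ.box ε j ⊆ Metric.ball x ((√n + 1) * ε) := by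
  intro y hy
  rw [Metric.mem_ball, θ.dist_eq_sqrt_coords]
  have h : ∑ i, (θ.coords y i - θ.coords x i) ^ 2 ≤ n * ε ^ 2 := by
    calc ∑ i, (θ.coords y i - θ.coords x i) ^ 2 ≤ ∑ _i : Fin n, ε ^ 2 := by
          refine Finset.sum_le_sum fun i _ => sq_le_sq' ?_ ?_
          · linarith [hx i, hy i]
          · linarith [hx i, hy i]
      _ = n * ε ^ 2 := by simp
  calc √(∑ i, (θ.coords y i - θ.coords x i) ^ 2) ≤ √(n * ε ^ 2) := Real.sqrt_le_sqrt h
    _ = √n * ε := by rw [Real.sqrt_mul (Nat.cast_nonneg n), Real.sqrt_sq hε.le]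
    _ < (√n + 1) * ε := by linarith

/-- The boxes of side `ε` meeting a bounded set are contained in a family of at most
`K ε⁻ⁿ` boxes. -/
theorem exists_finset_box_card_le {X : Set (Euc n)} (hX : Bornology.IsBounded X) :
    ∃ K : ℝ, 0 < K ∧ ∀ ε : ℝ, 0 < ε → ε ≤ 1 → ∃ J : Finset (Fin n → ℤ),
      (J.card : ℝ) * ε ^ n ≤ K ∧ ∀ j ∉ J, Disjoint (θ.box ε j) X := by
  obtain ⟨R, hR0, hR⟩ := hX.subset_closedBall_lt 0 θ.origin
  refine ⟨(2 * R + 2) ^ n, by positivity, fun ε hε hε1 => ?_⟩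
  refine ⟨Fintype.piFinset fun _ => Finset.Icc ⌊-R / ε⌋ ⌊R / ε⌋, ?_, ?_⟩
  · rw [Fintype.card_piFinset_const, Int.card_Icc, Nat.cast_pow, ← mul_pow]
    refine pow_le_pow_left₀ (by positivity) ?_ n
    have h0 : ⌊-R / ε⌋ ≤ ⌊R / ε⌋ := Int.floor_le_floor (by gcongr; linarith)
    have hcast : ((⌊R / ε⌋ + 1 - ⌊-R / ε⌋).toNat : ℝ) = (⌊R / ε⌋ : ℝ) + 1 - ⌊-R / ε⌋ := by
      exact_mod_cast congrArg (Int.cast (R := ℝ))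
        (Int.toNat_of_nonneg (a := ⌊R / ε⌋ + 1 - ⌊-R / ε⌋) (by omega))
    rw [hcast]
    have h1 := Int.floor_le (R / ε)
    have h2 := Int.lt_floor_add_one (-R / ε)
    calc ((⌊R / ε⌋ : ℝ) + 1 - ⌊-R / ε⌋) * ε ≤ (R / ε + 1 + (1 - -R / ε)) * ε := by
          gcongr
          linarith
      _ = 2 * R + 2 * ε := by field_simp; ring
      _ ≤ 2 * R + 2 := by linarith
  · intro j hj
    refine disjoint_left.2 fun x hx hxX => hj ?_
    rw [Fintype.mem_piFinset]
    intro i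
    have := abs_le.1 ((θ.abs_coords_le x i).trans (Metric.mem_closedBall.1 (hR hxX)))
    rw [← (θ.mem_box_iff hε j x).1 hx i, Finset.mem_Icc]
    constructor
    · exact Int.floor_le_floor (by gcongr; exact this.1)
    · exact Int.floor_le_floor (by gcongr; exact this.2)

end Grid

section Comparison

variable {n : ℕ} {T : Euc n → Euc n} {μ : Measure (Euc n)}

theorem ennreal_rpow_anti {a b : ℝ≥0∞} (h : a ≤ b) {z : ℝ} (hz : z ≤ 0) : b ^ z ≤ a ^ z := by
  rw [← neg_neg z, ENNReal.rpow_neg, ENNReal.rpow_neg a]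
  exact ENNReal.inv_le_inv.2 (ENNReal.rpow_le_rpow h (neg_nonneg.2 hz))

theorem retPF_eq_tsum (θ : Grid n) {ε : ℝ} (hε : 0 < ε) (δ q : ℝ) :
    retPF T μ δ q = ∑' j, ∫⁻ x in θ.box ε j,
      (firstReturn T (Metric.ball x δ) x : ℝ≥0∞) ^ (1 - q) ∂μ := by
  rw [← lintegral_iUnion (θ.measurableSet_box ε) (θ.pairwise_disjoint_box hε),
    θ.iUnion_box hε, Measure.restrict_univ, retPF]

theorem retPFlog_nonpos (δ : ℝ) : retPFlog T μ δ ≤ 0 := by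
  refine integral_nonpos fun x => ?_
  change Real.log _ ≤ 0
  rw [Real.log_inv]
  exact neg_nonpos.2 (Real.log_natCast_nonneg _)

theorem boxRetPFlog_eq_neg_sum {X : Set (Euc n)} (hX : μ Xᶜ = 0) (θ : Grid n) {ε : ℝ}
    {J : Finset (Fin n → ℤ)} (hJ : ∀ j ∉ J, Disjoint (θ.box ε j) X) :
    boxRetPFlog T μ θ ε =
      -∑ j ∈ J, ∫ x in θ.box ε j, Real.log (firstReturn T (θ.box ε j) x : ℝ) ∂μ := by
  simp only [boxRetPFlog, Real.log_inv, integral_neg]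
  rw [tsum_eq_sum (s := J), Finset.sum_neg_distrib]
  intro j hj
  rw [setIntegral_measure_zero _ (measure_mono_null (hJ j hj).subset_compl_right hX), neg_zero]

variable [IsProbabilityMeasure μ]

theorem ae_restrict_firstReturn_ball_le (hT : MeasurePreserving T μ μ) (θ : Grid n) {ε : ℝ}
    (hε : 0 < ε) (j : Fin n → ℤ) : ∀ᵐ x ∂μ.restrict (θ.box ε j),
      0 < firstReturn T (Metric.ball x ((√n + 1) * ε)) x ∧
      firstReturn T (Metric.ball x ((√n + 1) * ε)) x ≤ firstReturn T (θ.box ε j) x := by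
  filter_upwards [ae_restrict_firstReturn_pos hT (θ.measurableSet_box ε j),
    ae_restrict_mem (θ.measurableSet_box ε j)] with x hpos hx
  exact firstReturn_anti (θ.box_subset_ball hε hx) hpos

theorem ae_firstReturn_ball_pos (hT : MeasurePreserving T μ μ) {ε : ℝ} (hε : 0 < ε) :
    ∀ᵐ x ∂μ, 0 < firstReturn T (Metric.ball x ε) x := by
  have hC : 0 < √(n : ℝ) + 1 := by positivity
  let θ : Grid n := ⟨0, LinearIsometryEquiv.refl ℝ _⟩
  have hδ : 0 < ε / (√n + 1) := div_pos hε hC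
  rw [← Measure.restrict_univ (μ := μ), ← θ.iUnion_box hδ, ae_restrict_iUnion_iff]
  intro j
  filter_upwards [ae_restrict_firstReturn_ball_le hT θ hδ j] with x hx
  rw [mul_div_cancel₀ _ hC.ne'] at hx
  exact hx.1

theorem retPF_le_boxRetPF (hT : MeasurePreserving T μ μ) (θ : Grid n) {ε q : ℝ}
    (hε : 0 < ε) (hq : q < 1) : retPF T μ ((√n + 1) * ε) q ≤ boxRetPF T μ θ ε q := by
  rw [retPF_eq_tsum θ hε]
  refine ENNReal.tsum_le_tsum fun j => lintegral_mono_ae ?_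
  filter_upwards [ae_restrict_firstReturn_ball_le hT θ hε j] with x hx
  exact ENNReal.rpow_le_rpow (by exact_mod_cast hx.2) (by linarith)

theorem boxRetPF_le_retPF (hT : MeasurePreserving T μ μ) (θ : Grid n) {ε q : ℝ}
    (hε : 0 < ε) (hq : 1 < q) : boxRetPF T μ θ ε q ≤ retPF T μ ((√n + 1) * ε) q := by
  rw [retPF_eq_tsum θ hε]
  refine ENNReal.tsum_le_tsum fun j => lintegral_mono_ae ?_
  filter_upwards [ae_restrict_firstReturn_ball_le hT θ hε j] with x hx
  exact ennreal_rpow_anti (by exact_mod_cast hx.2) (by linarith)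

theorem one_le_retPF (hT : MeasurePreserving T μ μ) {ε q : ℝ} (hε : 0 < ε) (hq : q < 1) :
    1 ≤ retPF T μ ε q := by
  calc (1 : ℝ≥0∞) = ∫⁻ _, 1 ∂μ := by simp
    _ ≤ retPF T μ ε q := by
      refine lintegral_mono_ae ?_
      filter_upwards [ae_firstReturn_ball_pos hT hε] with x hx
      rw [← ENNReal.one_rpow (1 - q)]
      exact ENNReal.rpow_le_rpow (by exact_mod_cast hx) (by linarith)

theorem retPF_le_one (hT : MeasurePreserving T μ μ) {ε q : ℝ} (hε : 0 < ε) (hq : 1 < q) :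
    retPF T μ ε q ≤ 1 := by
  calc retPF T μ ε q ≤ ∫⁻ _, 1 ∂μ := by
        refine lintegral_mono_ae ?_
        filter_upwards [ae_firstReturn_ball_pos hT hε] with x hx
        rw [← ENNReal.one_rpow (1 - q)]
        exact ennreal_rpow_anti (by exact_mod_cast hx) (by linarith)
    _ = 1 := by simp

theorem integrableOn_log_firstReturn (hT : MeasurePreserving T μ μ) {A : Set (Euc n)}
    (hA : MeasurableSet A) :
    IntegrableOn (fun x => Real.log (firstReturn T A x : ℝ)) A μ := by
  have hm : Measurable fun x => Real.log (firstReturn T A x : ℝ) :=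
    (measurable_from_top (f := fun k : ℕ => Real.log (k : ℝ))).comp
      (measurable_firstReturn hT.measurable hA)
  refine (integrableOn_firstReturn hT hA).1.mono' hm.aestronglyMeasurable
    (Eventually.of_forall fun x => ?_)
  rw [Real.norm_of_nonneg (Real.log_natCast_nonneg _)]
  exact Real.log_le_self (Nat.cast_nonneg _)

theorem setIntegral_log_firstReturn_le (hT : MeasurePreserving T μ μ) {A : Set (Euc n)}
    (hA : MeasurableSet A) {s : ℝ} (hs : 0 < s) (hs1 : s ≤ 1) :
    ∫ x in A, Real.log (firstReturn T A x : ℝ) ∂μ ≤ s + μ.real A * -Real.log s := by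
  obtain ⟨hint_on, hle⟩ := integrableOn_firstReturn hT hA
  have hlog : ∀ x, Real.log (firstReturn T A x : ℝ) ≤
      s * (firstReturn T A x : ℝ) + -Real.log s := by
    intro x
    rcases Nat.eq_zero_or_pos (firstReturn T A x) with h | h
    · simpa [h] using Real.log_nonpos hs.le hs1
    · have hpos : (0 : ℝ) < firstReturn T A x := by exact_mod_cast h
      have := Real.log_le_sub_one_of_pos (mul_pos hs hpos)
      rw [Real.log_mul hs.ne' hpos.ne'] at this
      linarith
  calc ∫ x in A, Real.log (firstReturn T A x : ℝ) ∂μ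
      ≤ ∫ x in A, (s * (firstReturn T A x : ℝ) + -Real.log s) ∂μ :=
        integral_mono (integrableOn_log_firstReturn hT hA)
          ((hint_on.const_mul s).add (integrable_const _)) hlog
    _ = s * ∫ x in A, (firstReturn T A x : ℝ) ∂μ + μ.real A * -Real.log s := by
        rw [integral_add (hint_on.const_mul s) (integrable_const _), integral_const_mul,
          setIntegral_const, smul_eq_mul]
    _ ≤ s + μ.real A * -Real.log s := by nlinarith

theorem neg_boxRetPFlog_le (hT : MeasurePreserving T μ μ) {X : Set (Euc n)} (hX : μ Xᶜ = 0)
    (θ : Grid n) {ε : ℝ} (hε : 0 < ε) (hε1 : ε ≤ 1) {J : Finset (Fin n → ℤ)}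
    (hJ : ∀ j ∉ J, Disjoint (θ.box ε j) X) :
    -boxRetPFlog T μ θ ε ≤ J.card * ε ^ n + n * -Real.log ε := by
  have hs : 0 < ε ^ n := pow_pos hε n
  have hs1 : ε ^ n ≤ 1 := pow_le_one₀ hε.le hε1
  have hμ : ∑ j ∈ J, μ.real (θ.box ε j) ≤ 1 := by
    rw [← measureReal_biUnion_finset
      (fun i _ j _ hij => θ.pairwise_disjoint_box hε hij)
      (fun j _ => θ.measurableSet_box ε j)]
    exact measureReal_le_one
  rw [boxRetPFlog_eq_neg_sum hX θ hJ, neg_neg]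
  calc ∑ j ∈ J, ∫ x in θ.box ε j, Real.log (firstReturn T (θ.box ε j) x : ℝ) ∂μ
      ≤ ∑ j ∈ J, (ε ^ n + μ.real (θ.box ε j) * -Real.log (ε ^ n)) :=
        Finset.sum_le_sum fun j _ =>
          setIntegral_log_firstReturn_le hT (θ.measurableSet_box ε j) hs hs1
    _ = J.card * ε ^ n + (∑ j ∈ J, μ.real (θ.box ε j)) * -Real.log (ε ^ n) := by
        rw [Finset.sum_add_distrib, Finset.sum_const, nsmul_eq_mul, Finset.sum_mul]
    _ ≤ J.card * ε ^ n + 1 * -Real.log (ε ^ n) := by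
        gcongr
        exact neg_nonneg.2 (Real.log_nonpos hs.le hs1)
    _ = J.card * ε ^ n + n * -Real.log ε := by
        rw [Real.log_pow]
        ring

theorem boxRetPFlog_le_retPFlog (hT : MeasurePreserving T μ μ) {X : Set (Euc n)}
    (hX : μ Xᶜ = 0) (θ : Grid n) {ε : ℝ} (hε : 0 < ε) {J : Finset (Fin n → ℤ)}
    (hJ : ∀ j ∉ J, Disjoint (θ.box ε j) X) :
    boxRetPFlog T μ θ ε ≤ retPFlog T μ ((√n + 1) * ε) := by
  set τ : Euc n → ℕ := fun x => firstReturn T (Metric.ball x ((√n + 1) * ε)) x with hτ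
  have hm : Measurable fun x => Real.log (τ x : ℝ) :=
    (measurable_from_top (f := fun k : ℕ => Real.log (k : ℝ))).comp
      (measurable_firstReturn_ball hT.measurable _)
  have hle : ∀ j, ∀ᵐ x ∂μ.restrict (θ.box ε j),
      Real.log (τ x : ℝ) ≤ Real.log (firstReturn T (θ.box ε j) x : ℝ) := by
    intro j
    filter_upwards [ae_restrict_firstReturn_ball_le hT θ hε j] with x hx
    exact Real.log_le_log (by exact_mod_cast hx.1) (by exact_mod_cast hx.2)
  have hint_on : ∀ j, IntegrableOn (fun x => Real.log (τ x : ℝ)) (θ.box ε j) μ := by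
    intro j
    refine (integrableOn_log_firstReturn hT (θ.measurableSet_box ε j)).mono'
      hm.aestronglyMeasurable ((hle j).mono fun x hx => ?_)
    rwa [Real.norm_of_nonneg (Real.log_natCast_nonneg _)]
  have hcover : ∀ᵐ x ∂μ, x ∈ ⋃ j ∈ J, θ.box ε j := by
    have hmem : ∀ᵐ x ∂μ, x ∈ X := mem_ae_iff.2 hX
    filter_upwards [hmem] with x hxX
    obtain ⟨j, hj⟩ := mem_iUnion.1 ((θ.iUnion_box hε).symm ▸ mem_univ x)
    refine mem_biUnion (x := j) ?_ hj
    by_contra hjJ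
    exact disjoint_left.1 (hJ j hjJ) hj hxX
  have hret : retPFlog T μ ((√n + 1) * ε) =
      -∑ j ∈ J, ∫ x in θ.box ε j, Real.log (τ x : ℝ) ∂μ := by
    rw [← integral_biUnion_finset J (fun j _ => θ.measurableSet_box ε j)
      (fun i _ j _ hij => θ.pairwise_disjoint_box hε hij) (fun j _ => hint_on j),
      Measure.restrict_eq_self_of_ae_mem hcover, ← integral_neg]
    simp only [retPFlog, Real.log_inv, hτ]
  rw [boxRetPFlog_eq_neg_sum hX θ hJ, hret, neg_le_neg_iff]
  exact Finset.sum_le_sum fun j _ => integral_mono_ae (hint_on j)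
    (integrableOn_log_firstReturn hT (θ.measurableSet_box ε j)) (hle j)

end Comparison

/-- For an ergodic dynamical system, for every grid `θ` and every real `q`,
the box return time dimensions dominate the generalized return time dimensions. -/
theorem box_return_dims_ge_generalized_return_dims {n : ℕ} (T : Euc n → Euc n)
    (μ : Measure (Euc n)) [IsProbabilityMeasure μ] (X : Set (Euc n))
    (hXc : IsCompact X) (hX1 : μ X = 1) (hTX : Set.MapsTo T X X)
    (hErg : Ergodic T μ) :
    ∀ (θ : Grid n) (q : ℝ),
      DtauPlus T μ q ≤ DeltaTauPlus T μ θ q ∧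
        DtauMinus T μ q ≤ DeltaTauMinus T μ θ q := by
  intro θ q
  have hT := hErg.toMeasurePreserving
  have hC : 0 < √(n : ℝ) + 1 := by positivity
  have hX : μ Xᶜ = 0 := (prob_compl_eq_zero_iff hXc.measurableSet).2 hX1
  unfold DtauPlus DtauMinus DeltaTauPlus DeltaTauMinus dimPlus dimMinus
  split_ifs with hq
  · obtain ⟨K, hK, hJ⟩ := θ.exists_finset_box_card_le hXc.isBounded
    rw [EReal.coe_le_coe_iff, EReal.coe_le_coe_iff]
    refine limsup_liminf_le_of_rescale_real hC (B := K + n) (by positivity) ?_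
    filter_upwards [eventually_log_neg hC,
      Real.tendsto_log_nhdsGT_zero.eventually_le_atBot (-1)] with ε ⟨h0, h1, h2⟩ h3
    have hε1 : ε ≤ 1 := (Real.log_neg_iff h0).1 h1 |>.le
    obtain ⟨J, hcard, hdisj⟩ := hJ ε h0 hε1
    refine ⟨div_nonneg_of_nonpos (retPFlog_nonpos _) h2.le, ?_, ?_⟩
    · rw [div_mul_div_cancel₀ h2.ne]
      exact div_le_div_of_nonpos_of_le h1.le (boxRetPFlog_le_retPFlog hT hX θ h0 hdisj)
    · rw [div_le_iff_of_neg h1]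
      have := neg_boxRetPFlog_le hT hX θ h0 hε1 hdisj
      nlinarith
  · refine limsup_liminf_le_of_rescale_ereal hC (dimScale_rescale_le hC ?_)
    rcases lt_or_gt_of_ne hq with hq | hq
    · exact Or.inl ⟨hq, fun ε hε => ⟨one_le_retPF hT hε hq, retPF_le_boxRetPF hT θ hε hq⟩⟩
    · exact Or.inr ⟨hq, fun ε hε => ⟨retPF_le_one hT hε hq, boxRetPF_le_retPF hT θ hε hq⟩⟩
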